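/- Up to isomorphism there is only one left-invariant symplectic structure on G_{n,p}(𝕂): if α and α' are linear forms on 𝒢_{n,p}(𝕂) such that the 2-coboundaries δα and δα' are both nondegenerate (i.e. δα(a,b) = 0 for all b implies a = 0, and likewise for δα'), then there exists a Lie algebra automorphism φ of 𝒢_{n,p}(𝕂) such that α([a,b]) = α'([φ(a), φ(b)]) for all a, b ∈ 𝒢_{n,p}(𝕂). -/

import Mathlib

open Matrix

/-- The underlying space of the Lie algebra `𝒢_{n,p}(𝕂) = M_{n,p}(𝕂) × gl(n,𝕂)`. -/
abbrev GA (𝕂 : Type) [RCLike 𝕂] (n p : ℕ) : Type :=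
  Matrix (Fin n) (Fin p) 𝕂 × Matrix (Fin n) (Fin n) 𝕂

/-- The Lie bracket `[(x,u),(y,v)] = (u·y − v·x, u·v − v·u)` of `𝒢_{n,p}(𝕂)`. -/
def bkt {𝕂 : Type} [RCLike 𝕂] {n p : ℕ} (a b : GA 𝕂 n p) : GA 𝕂 n p :=
  (a.2 * b.1 - b.2 * a.1, a.2 * b.2 - b.2 * a.2)

section helpers
variable {𝕂 : Type} [RCLike 𝕂]

lemma exists_inv_of_inj {ι κ : Type} [Fintype ι] [Fintype κ] [DecidableEq ι] [DecidableEq κ]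
    (hc : Fintype.card ι = Fintype.card κ) (O : Matrix ι κ 𝕂)
    (h : ∀ v, O *ᵥ v = 0 → v = 0) : ∃ D : Matrix κ ι 𝕂, O * D = 1 ∧ D * O = 1 := by
  obtain ⟨e⟩ := Fintype.card_eq.mp hc
  have hu : IsUnit (O.submatrix e.symm id) := by
    rw [← Matrix.mulVec_injective_iff_isUnit, ← Matrix.coe_mulVecLin, ← LinearMap.ker_eq_bot,
      LinearMap.ker_eq_bot']
    intro v hv
    apply h
    funext i
    have := congrFun hv (e i)
    simpa [Matrix.mulVec, dotProduct] using this
  obtain ⟨⟨U, W, h1, h2⟩, rfl : U = _⟩ := hu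
  have key : (W.submatrix id e) * O = 1 := by
    rw [← h2]
    ext i j
    simp only [Matrix.mul_apply, Matrix.submatrix_apply, id]
    exact Fintype.sum_equiv e _ _ (by simp)
  refine ⟨W.submatrix id e, ?_, key⟩
  have : ((O.submatrix e.symm id) * W).submatrix e e = 1 := by rw [h1]; simp
  rw [← this]
  ext i j
  simp [Matrix.mul_apply]

/-- rows of degree less than `t` -/
def Qm {n p : ℕ} (A : Matrix (Fin p) (Fin n) 𝕂) (B : Matrix (Fin n) (Fin n) 𝕂) (t : ℕ) :
    Submodule 𝕂 (Matrix Unit (Fin n) 𝕂) where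
  carrier := {r | ∃ c : ℕ → Matrix Unit (Fin p) 𝕂, r = ∑ i ∈ Finset.range t, c i * A * B ^ i}
  add_mem' := by
    rintro _ _ ⟨c, rfl⟩ ⟨d, rfl⟩
    exact ⟨c + d, by simp [Matrix.add_mul, Finset.sum_add_distrib]⟩
  zero_mem' := ⟨0, by simp⟩
  smul_mem' := by
    rintro a _ ⟨c, rfl⟩
    exact ⟨a • c, by simp [Finset.smul_sum]⟩

lemma Qm_mem {n p : ℕ} (A : Matrix (Fin p) (Fin n) 𝕂) (B : Matrix (Fin n) (Fin n) 𝕂) (t i : ℕ)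
    (h : i < t) (e : Matrix Unit (Fin p) 𝕂) : e * A * B ^ i ∈ Qm A B t := by
  refine ⟨fun j => if j = i then e else 0, ?_⟩
  rw [Finset.sum_eq_single i]
  · simp
  · intro b _ hb; simp [hb]
  · intro hi; exact absurd (Finset.mem_range.2 h) hi

def ND {n p : ℕ} (A : Matrix (Fin p) (Fin n) 𝕂) (B : Matrix (Fin n) (Fin n) 𝕂) : Prop :=
  ∀ (x : Matrix (Fin n) (Fin p) 𝕂) (u : Matrix (Fin n) (Fin n) 𝕂), A * u = 0 → x * A = B * u - u * B → x = 0 ∧ u = 0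

lemma exists_w {n p s : ℕ} (A : Matrix (Fin p) (Fin n) 𝕂) (B : Matrix (Fin n) (Fin n) 𝕂)
    (h : s * p < n) : ∃ w : Matrix (Fin n) Unit 𝕂, (∀ i < s, A * B ^ i * w = 0) ∧
      ∃ f : Matrix Unit (Fin n) 𝕂, f * w = 1 := by
  let M : Matrix (Fin s × Fin p) (Fin n) 𝕂 := Matrix.of fun q l => (A * B ^ (q.1 : ℕ)) q.2 l
  have hk := LinearMap.ker_ne_bot_of_finrank_lt (f := M.mulVecLin) (by simpa using h)
  obtain ⟨v, hv, hv0⟩ := (Submodule.ne_bot_iff _).1 hk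
  refine ⟨Matrix.replicateCol Unit v, ?_, ?_⟩
  · intro i hi
    ext j u
    have := congrFun (show M *ᵥ v = 0 from hv) (⟨i, hi⟩, j)
    simpa [M, Matrix.mulVec, dotProduct, Matrix.mul_apply] using this
  · obtain ⟨i, hi⟩ := Function.ne_iff.1 hv0
    refine ⟨Matrix.replicateRow Unit (Pi.single i (v i)⁻¹), ?_⟩
    ext a b
    simp only [Pi.zero_apply] at hi
    simp [Matrix.mul_apply, Pi.single_apply, hi]

lemma stepS {n p s : ℕ} (A : Matrix (Fin p) (Fin n) 𝕂) (B : Matrix (Fin n) (Fin n) 𝕂)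
    (hnd : ND A B) (h : (s + 1) * p < n)
    (ih : ∀ e : Matrix Unit (Fin p) 𝕂, e * A * B ^ s ∈ Qm A B s → e = 0)
    (e : Matrix Unit (Fin p) 𝕂) (he : e * A * B ^ (s + 1) ∈ Qm A B (s + 1)) : e = 0 := by
  obtain ⟨c, hc⟩ := he
  obtain ⟨w, hw, f, hf⟩ := exists_w A B h
  let ψ : ℕ → Matrix Unit (Fin n) 𝕂 := fun t =>
    e * A * B ^ t - ∑ i ∈ Finset.range t, c (i + (s + 1 - t)) * A * B ^ i
  have ψs : ψ (s + 1) = 0 := by simp [ψ, hc]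
  have ψ0 : ψ 0 = e * A := by simp [ψ]
  have ψr : ∀ t, t < s + 1 → ψ t * B = ψ (t + 1) + c (s - t) * A := by
    intro t ht
    simp only [ψ]
    rw [Finset.sum_range_succ', Matrix.sub_mul, Matrix.sum_mul]
    have : ∀ i ∈ Finset.range t, c (i + (s + 1 - t)) * A * B ^ i * B
        = c (i + 1 + (s + 1 - (t + 1))) * A * B ^ (i + 1) := by
      intro i hi
      rw [show i + 1 + (s + 1 - (t + 1)) = i + (s + 1 - t) by omega, pow_succ]
      simp only [Matrix.mul_assoc]
    rw [Finset.sum_congr rfl this, pow_succ, show 0 + (s + 1 - (t + 1)) = s - t by omega]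
    simp only [Matrix.mul_assoc, pow_zero, Matrix.mul_one]
    abel
  let u : Matrix (Fin n) (Fin n) 𝕂 := ∑ j ∈ Finset.range (s + 1), B ^ j * w * ψ (s - j)
  have hAu : A * u = 0 := by
    simp only [u]
    rw [Matrix.mul_sum]
    apply Finset.sum_eq_zero
    intro j hj
    rw [← Matrix.mul_assoc, ← Matrix.mul_assoc, hw j (Finset.mem_range.1 hj), Matrix.zero_mul]
  have hBu : (B ^ (s + 1) * w * e - ∑ j ∈ Finset.range (s + 1), B ^ j * w * c j) * A
      = B * u - u * B := by
    have tel := Finset.sum_range_sub (fun j => B ^ j * w * ψ (s + 1 - j)) (s + 1)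
    simp only [u]
    rw [Matrix.mul_sum, Matrix.sum_mul, ← Finset.sum_sub_distrib, Matrix.sub_mul, Matrix.sum_mul]
    have : ∀ j ∈ Finset.range (s + 1), B * (B ^ j * w * ψ (s - j)) - B ^ j * w * ψ (s - j) * B
        = (B ^ (j + 1) * w * ψ (s + 1 - (j + 1)) - B ^ j * w * ψ (s + 1 - j))
          - B ^ j * w * c j * A := by
      intro j hj
      have hj := Finset.mem_range.1 hj
      rw [Matrix.mul_assoc (B ^ j * w) (ψ _) B, ψr (s - j) (by omega),
        show s - (s - j) = j by omega, show s - j + 1 = s + 1 - j by omega,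
        show s + 1 - (j + 1) = s - j by omega, pow_succ', Matrix.mul_add]
      simp only [Matrix.mul_assoc]
      abel
    rw [Finset.sum_congr rfl this, Finset.sum_sub_distrib, tel]
    simp [ψs, ψ0, Matrix.mul_assoc]
  obtain ⟨-, hu⟩ := hnd _ _ hAu hBu
  apply ih
  have hfu : f * u = 0 := by rw [hu, Matrix.mul_zero]
  have hψQ : ∀ t t', t < t' → ψ t ∈ Qm A B t' := by
    intro t t' htt
    apply Submodule.sub_mem
    · exact Qm_mem _ _ _ _ htt _
    · apply Submodule.sum_mem
      intro i hi
      exact Qm_mem _ _ _ _ (by have := Finset.mem_range.1 hi; omega) _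
  simp only [u] at hfu
  rw [Matrix.mul_sum, Finset.sum_range_succ'] at hfu
  simp only [pow_zero, Matrix.one_mul, Nat.sub_zero] at hfu
  rw [← Matrix.mul_assoc f w, hf, Matrix.one_mul] at hfu
  have h1 : e * A * B ^ s = (∑ i ∈ Finset.range s, c (i + (s + 1 - s)) * A * B ^ i)
      - ∑ k ∈ Finset.range s, f * (B ^ (k + 1) * w * ψ (s - (k + 1))) := by
    rw [eq_sub_iff_add_eq, ← sub_eq_zero, ← hfu]
    simp only [ψ]
    abel
  rw [h1]
  apply Submodule.sub_mem
  · apply Submodule.sum_mem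
    intro i hi
    exact Qm_mem _ _ _ _ (Finset.mem_range.1 hi) _
  · apply Submodule.sum_mem
    intro i hi
    have hi := Finset.mem_range.1 hi
    have : f * (B ^ (i + 1) * w * ψ (s - (i + 1))) =
        ((f * (B ^ (i + 1) * w)) () ()) • ψ (s - (i + 1)) := by
      rw [← Matrix.mul_assoc]
      ext a b
      simp [Matrix.mul_apply (M := f * (B ^ (i + 1) * w))]
    rw [this]
    exact Submodule.smul_mem _ _ (hψQ _ _ (by omega))

lemma allS {n p k : ℕ} (A : Matrix (Fin p) (Fin n) 𝕂) (B : Matrix (Fin n) (Fin n) 𝕂)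
    (hp : 1 ≤ p) (hn : n = k * p) (hnd : ND A B) (s : ℕ) (hs : s < k) :
    ∀ e : Matrix Unit (Fin p) 𝕂, e * A * B ^ s ∈ Qm A B s → e = 0 := by
  have hn0 : 0 < n := by subst hn; exact Nat.mul_pos (by omega) hp
  induction s with
  | zero =>
    rintro e ⟨c, hc⟩
    simp only [pow_zero, Matrix.mul_one, Finset.range_zero, Finset.sum_empty] at hc
    have := (hnd ((Matrix.of fun _ _ => 1 : Matrix (Fin n) Unit 𝕂) * e) 0 (by simp)
      (by rw [Matrix.mul_assoc, hc]; simp)).1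
    ext a j
    have h2 := congrFun (congrFun this ⟨0, hn0⟩) j
    simpa [Matrix.mul_apply] using h2
  | succ s ih =>
    apply stepS A B hnd _ (ih (by omega))
    subst hn
    exact Nat.mul_lt_mul_of_pos_right hs hp

lemma allR {n p k : ℕ} (A : Matrix (Fin p) (Fin n) 𝕂) (B : Matrix (Fin n) (Fin n) 𝕂)
    (hp : 1 ≤ p) (hn : n = k * p) (hnd : ND A B) (s : ℕ) (hs : s ≤ k)
    (c : ℕ → Matrix Unit (Fin p) 𝕂) (hc : ∑ i ∈ Finset.range s, c i * A * B ^ i = 0) :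
    ∀ i < s, c i = 0 := by
  induction s with
  | zero => intro i hi; omega
  | succ s ih =>
    rw [Finset.sum_range_succ] at hc
    have h0 : c s = 0 := by
      apply allS A B hp hn hnd s (by omega)
      rw [eq_neg_of_add_eq_zero_right hc]
      exact Submodule.neg_mem _ ⟨c, rfl⟩
    intro i hi
    rcases Nat.lt_succ_iff_lt_or_eq.1 hi with h | h
    · exact ih (by omega) (by simpa [h0] using hc) i h
    · rw [h, h0]

lemma exists_T {n p k : ℕ} (A : Matrix (Fin p) (Fin n) 𝕂) (B : Matrix (Fin n) (Fin n) 𝕂)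
    (hp : 1 ≤ p) (hn : n = k * p) (hnd : ND A B) :
    ∃ T : Matrix (Fin n) (Fin p) 𝕂, ∀ i < k, A * B ^ i * T = if i + 1 = k then 1 else 0 := by
  let O : Matrix (Fin k × Fin p) (Fin n) 𝕂 := Matrix.of fun q l => (A * B ^ (q.1 : ℕ)) q.2 l
  obtain ⟨D, h1, h2⟩ := exists_inv_of_inj (by simp [hn]) Oᵀ (by
    intro v hv
    let c : ℕ → Matrix Unit (Fin p) 𝕂 := fun i =>
      Matrix.of fun _ j => if h : i < k then v (⟨i, h⟩, j) else 0
    have := allR A B hp hn hnd k le_rfl c (by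
      ext a l
      have := congrFun hv l
      simp only [Matrix.mulVec, dotProduct, Fintype.sum_prod_type, Pi.zero_apply,
        Matrix.transpose_apply, O, Matrix.of_apply] at this
      rw [Matrix.sum_apply, Finset.sum_range, Matrix.zero_apply, ← this]
      apply Finset.sum_congr rfl
      intro i _
      rw [Matrix.mul_assoc, Matrix.mul_apply]
      apply Finset.sum_congr rfl
      intro j _
      simp [c, mul_comm])
    funext ⟨i, j⟩
    have h := congrFun (congrFun (this i i.2) ()) j
    simpa [c] using h)
  have hOD : O * Dᵀ = 1 := by
    have := congrArg Matrix.transpose h2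
    simpa using this
  let E : Matrix (Fin k × Fin p) (Fin p) 𝕂 := Matrix.of fun q l =>
    if (q.1 : ℕ) + 1 = k then (1 : Matrix (Fin p) (Fin p) 𝕂) q.2 l else 0
  refine ⟨Dᵀ * E, ?_⟩
  have hT : O * (Dᵀ * E) = E := by rw [← Matrix.mul_assoc, hOD, Matrix.one_mul]
  intro i hi
  ext j l
  have h := congrFun (congrFun hT (⟨i, hi⟩, j)) l
  have h3 : (A * B ^ i * (Dᵀ * E)) j l = (O * (Dᵀ * E)) (⟨i, hi⟩, j) l := by
    rw [Matrix.mul_apply, Matrix.mul_apply]; rfl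
  rw [h3, h]
  simp only [E, Matrix.of_apply]
  split_ifs <;> rfl

def A0 (𝕂 : Type) [RCLike 𝕂] (k p : ℕ) : Matrix (Fin p) (Fin k × Fin p) 𝕂 := Matrix.of fun j q =>
  if (q.1 : ℕ) + 1 = k then (1 : Matrix (Fin p) (Fin p) 𝕂) j q.2 else 0

def N0 (𝕂 : Type) [RCLike 𝕂] (k p : ℕ) : Matrix (Fin k × Fin p) (Fin k × Fin p) 𝕂 :=
  Matrix.of fun q r => if (q.1 : ℕ) = r.1 + 1 ∧ q.2 = r.2 then 1 else 0

lemma normal_form {n p k : ℕ} (A : Matrix (Fin p) (Fin n) 𝕂) (B : Matrix (Fin n) (Fin n) 𝕂)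
    (hp : 1 ≤ p) (hk : 1 ≤ k) (hn : n = k * p) (hnd : ND A B) :
    ∃ (C : Matrix (Fin n) (Fin k × Fin p) 𝕂) (D : Matrix (Fin k × Fin p) (Fin n) 𝕂)
      (m : Matrix (Fin n) (Fin p) 𝕂), C * D = 1 ∧ D * C = 1 ∧ A * C = A0 𝕂 k p ∧
        (B - m * A) * C = C * N0 𝕂 k p := by
  obtain ⟨T, hT⟩ := exists_T A B hp hn hnd
  let C : Matrix (Fin n) (Fin k × Fin p) 𝕂 := Matrix.of fun l q => (B ^ (q.1 : ℕ) * T) l q.2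
  have hXC : ∀ {r : ℕ} (X : Matrix (Fin r) (Fin n) 𝕂) (i : Fin r) (q : Fin k × Fin p),
      (X * C) i q = (X * B ^ (q.1 : ℕ) * T) i q.2 := by
    intro r X i q
    rw [Matrix.mul_assoc, Matrix.mul_apply, Matrix.mul_apply]; rfl
  have hAC : A * C = A0 𝕂 k p := by
    ext j q
    rw [hXC, hT _ q.1.2]
    simp only [A0, Matrix.of_apply]
    split_ifs <;> rfl
  obtain ⟨D, h1, h2⟩ := exists_inv_of_inj (by simp [hn]) C (by
    intro v hv
    have key : ∀ r, ∀ i : Fin k, (i : ℕ) + r + 1 = k → ∀ j, v (i, j) = 0 := by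
      intro r
      induction r using Nat.strong_induction_on with
      | _ r ih =>
        intro i hi j
        have h : ((A * B ^ r) * C) *ᵥ v = 0 := by rw [← Matrix.mulVec_mulVec, hv, Matrix.mulVec_zero]
        have h := congrFun h j
        simp only [Matrix.mulVec, dotProduct, Fintype.sum_prod_type, Pi.zero_apply, hXC] at h
        rw [Finset.sum_eq_single i] at h
        · rw [Matrix.mul_assoc A, ← pow_add, hT _ (by omega), if_pos (by omega)] at h
          simpa [Matrix.one_apply] using h
        · intro i' _ hne
          rcases lt_or_gt_of_ne hne with hlt | hlt
          · have hlt' : (i' : ℕ) < i := hlt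
            apply Finset.sum_eq_zero
            intro l _
            rw [Matrix.mul_assoc A, ← pow_add, hT _ (by omega), if_neg (by omega)]
            simp
          · have hlt' : (i : ℕ) < i' := hlt
            apply Finset.sum_eq_zero
            intro l _
            rw [ih (k - 1 - i') (by omega) i' (by omega) l, mul_zero]
        · simp
    funext ⟨i, j⟩
    exact key (k - 1 - i) i (by omega) j)
  refine ⟨C, D, B ^ k * T, h1, h2, hAC, ?_⟩
  ext l q
  rw [Matrix.sub_mul, Matrix.sub_apply, hXC, ← pow_succ', Matrix.mul_assoc (B ^ k * T), hAC,
    Matrix.mul_apply (M := B ^ k * T), Matrix.mul_apply (M := C), Fintype.sum_prod_type]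
  have hlast := q.1.2
  by_cases hq : (q.1 : ℕ) + 1 = k
  · have hz : ∀ i j, N0 𝕂 k p (i, j) q = 0 := by
      intro i j
      have := i.2
      simp only [N0, Matrix.of_apply]
      rw [if_neg]; rintro ⟨h, -⟩; omega
    simp [hz, A0, hq, Matrix.one_apply]
  · have hz : ∀ j, A0 𝕂 k p j q = 0 := fun j => by simp [A0, hq]
    simp only [hz, mul_zero, Finset.sum_const_zero, sub_zero]
    rw [Finset.sum_eq_single (⟨q.1 + 1, by omega⟩ : Fin k)]
    · rw [Finset.sum_eq_single q.2]
      · simp [N0, C]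
      · intro j _ hj; simp [N0, hj]
      · simp
    · intro i _ hi
      apply Finset.sum_eq_zero
      intro j _
      simp only [N0, Matrix.of_apply]
      rw [if_neg, mul_zero]
      rintro ⟨h, -⟩
      exact hi (Fin.ext h)
    · simp

lemma form_rep {n p : ℕ} (α : GA 𝕂 n p →ₗ[𝕂] 𝕂) :
    ∃ (A : Matrix (Fin p) (Fin n) 𝕂) (B : Matrix (Fin n) (Fin n) 𝕂),
      ∀ a, α a = (A * a.1).trace + (B * a.2).trace := by
  have gen : ∀ {r q : ℕ} (β : Matrix (Fin r) (Fin q) 𝕂 →ₗ[𝕂] 𝕂),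
      ∃ A : Matrix (Fin q) (Fin r) 𝕂, ∀ x, β x = (A * x).trace := by
    intro r q β
    refine ⟨Matrix.of fun j i => β (Matrix.single i j 1), fun x => ?_⟩
    conv_lhs => rw [Matrix.matrix_eq_sum_single x]
    simp only [map_sum, Matrix.trace, Matrix.diag, Matrix.mul_apply, Matrix.of_apply]
    rw [Finset.sum_comm]
    refine Finset.sum_congr rfl fun j _ => Finset.sum_congr rfl fun i _ => ?_
    have : Matrix.single i j (x i j) = x i j • Matrix.single i j (1 : 𝕂) := by simp
    rw [this, map_smul, smul_eq_mul, mul_comm]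
  obtain ⟨A, hA⟩ := gen (α ∘ₗ LinearMap.inl 𝕂 _ _)
  obtain ⟨B, hB⟩ := gen (α ∘ₗ LinearMap.inr 𝕂 _ _)
  refine ⟨A, B, fun a => ?_⟩
  rw [← hA, ← hB]
  simp [← map_add]

lemma nd_of {n p : ℕ} (α : GA 𝕂 n p →ₗ[𝕂] 𝕂)
    (hα : ∀ a : GA 𝕂 n p, (∀ b : GA 𝕂 n p, -α (bkt a b) = 0) → a = 0)
    (A : Matrix (Fin p) (Fin n) 𝕂) (B : Matrix (Fin n) (Fin n) 𝕂)
    (h : ∀ a, α a = (A * a.1).trace + (B * a.2).trace) : ND A B := by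
  intro x u h1 h2
  have := hα (x, u) (by
    rintro ⟨y, v⟩
    rw [h]
    simp only [bkt, Matrix.mul_sub, Matrix.trace_sub]
    have e1 : (A * (u * y)).trace = 0 := by rw [← Matrix.mul_assoc, h1]; simp
    have e2 : (A * (v * x)).trace = (B * (u * v)).trace - (B * (v * u)).trace := by
      rw [← Matrix.mul_assoc, Matrix.trace_mul_comm, ← Matrix.mul_assoc, h2, Matrix.sub_mul,
        Matrix.trace_sub, ← Matrix.mul_assoc B v u, Matrix.trace_mul_comm (B * v) u]
      simp only [Matrix.mul_assoc]
    rw [e1, e2]; ring)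
  exact ⟨congrArg Prod.fst this, congrArg Prod.snd this⟩

end helpers

/-- Up to isomorphism there is only one left-invariant symplectic structure on
`G_{n,p}(𝕂)`: if `α, α'` are linear forms on `𝒢_{n,p}(𝕂)` whose coboundaries `δα, δα'`
(`δα(a,b) = −α([a,b])`) are nondegenerate, then some Lie algebra automorphism `φ` of
`𝒢_{n,p}(𝕂)` satisfies `δα(a,b) = δα'(φ(a), φ(b))` for all `a, b`. -/
theorem stmt13 (𝕂 : Type) [RCLike 𝕂] (p k n : ℕ) (hp : 1 ≤ p) (hk : 1 ≤ k)
    (hn : n = k * p)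
    (α α' : GA 𝕂 n p →ₗ[𝕂] 𝕂)
    (hα : ∀ a : GA 𝕂 n p, (∀ b : GA 𝕂 n p, -α (bkt a b) = 0) → a = 0)
    (hα' : ∀ a : GA 𝕂 n p, (∀ b : GA 𝕂 n p, -α' (bkt a b) = 0) → a = 0) :
    ∃ φ : GA 𝕂 n p ≃ₗ[𝕂] GA 𝕂 n p,
      (∀ a b : GA 𝕂 n p, φ (bkt a b) = bkt (φ a) (φ b)) ∧
      (∀ a b : GA 𝕂 n p, -α (bkt a b) = -α' (bkt (φ a) (φ b))) := by
  obtain ⟨A, B, h⟩ := form_rep α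
  obtain ⟨A', B', h'⟩ := form_rep α'
  obtain ⟨C, D, m, hCD, hDC, hA, hB⟩ := normal_form A B hp hk hn (nd_of α hα A B h)
  obtain ⟨C', D', m', hCD', hDC', hA', hB'⟩ := normal_form A' B' hp hk hn (nd_of α' hα' A' B' h')
  obtain ⟨g, hg⟩ : ∃ g, g = C' * D := ⟨_, rfl⟩
  obtain ⟨gi, hgi⟩ : ∃ gi, gi = C * D' := ⟨_, rfl⟩
  have g1 : g * gi = 1 := by
    rw [hg, hgi, Matrix.mul_assoc, ← Matrix.mul_assoc D, hDC, Matrix.one_mul, hCD']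
  have g2 : gi * g = 1 := by
    rw [hg, hgi, Matrix.mul_assoc, ← Matrix.mul_assoc D', hDC', Matrix.one_mul, hCD]
  have gA : A' * g = A := by
    rw [hg, ← Matrix.mul_assoc, hA', ← hA, Matrix.mul_assoc, hCD, Matrix.mul_one]
  have gB : (B' - m' * A') * g = g * (B - m * A) := by
    have e : B - m * A = C * N0 𝕂 k p * D := by
      rw [← hB, Matrix.mul_assoc, hCD, Matrix.mul_one]
    rw [e, hg, ← Matrix.mul_assoc, hB']
    simp only [Matrix.mul_assoc]
    rw [← Matrix.mul_assoc D C, hDC, Matrix.one_mul]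
  have gB2 : gi * B' * g = B + (gi * m' - m) * A := by
    have e : B' * g = g * (B - m * A) + m' * A := by
      rw [← gB, Matrix.sub_mul, Matrix.mul_assoc m', gA]; abel
    rw [Matrix.mul_assoc, e, Matrix.mul_add, ← Matrix.mul_assoc, g2, Matrix.one_mul, Matrix.sub_mul,
      Matrix.mul_assoc]
    abel
  obtain ⟨M, hM⟩ : ∃ M, M = m - gi * m' := ⟨_, rfl⟩
  have c1 : ∀ {r : ℕ} (X : Matrix (Fin n) (Fin r) 𝕂), g * (gi * X) = X := fun X => by
    rw [← Matrix.mul_assoc, g1, Matrix.one_mul]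
  have c2 : ∀ {r : ℕ} (X : Matrix (Fin n) (Fin r) 𝕂), gi * (g * X) = X := fun X => by
    rw [← Matrix.mul_assoc, g2, Matrix.one_mul]
  let φ : GA 𝕂 n p ≃ₗ[𝕂] GA 𝕂 n p :=
    { toFun := fun a => (g * (a.1 + a.2 * M), g * a.2 * gi)
      map_add' := fun a b => by
        ext1
        · simp only [Prod.fst_add, Prod.snd_add, Matrix.mul_add, Matrix.add_mul]; abel
        · simp only [Prod.snd_add, Matrix.mul_add, Matrix.add_mul]
      map_smul' := fun c a => by ext1 <;> simp [Matrix.mul_add]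
      invFun := fun a => (gi * a.1 - gi * a.2 * g * M, gi * a.2 * g)
      left_inv := fun a => by
        ext1
        · simp [Matrix.mul_assoc, c2, g2]
        · simp [Matrix.mul_assoc, c2, g2]
      right_inv := fun a => by
        ext1
        · simp [Matrix.mul_assoc, c1]
        · simp [Matrix.mul_assoc, c1, g1] }
  have hφ : ∀ a, φ a = (g * (a.1 + a.2 * M), g * a.2 * gi) := fun a => rfl
  have hom : ∀ a b : GA 𝕂 n p, φ (bkt a b) = bkt (φ a) (φ b) := by
    intro a b
    simp only [hφ, bkt]
    ext1
    · simp only [Matrix.mul_assoc, c2, Matrix.mul_add, Matrix.mul_sub, Matrix.sub_mul]; abel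
    · simp only [Matrix.mul_assoc, c2, Matrix.mul_sub, Matrix.sub_mul]
  refine ⟨φ, hom, fun a b => ?_⟩
  rw [← hom]
  generalize bkt a b = z
  rw [h, h', hφ]
  congr 1
  simp only
  have t1 : (A' * (g * (z.1 + z.2 * M))).trace = (A * z.1).trace + (M * A * z.2).trace := by
    rw [← Matrix.mul_assoc, gA, Matrix.mul_add, Matrix.trace_add, ← Matrix.mul_assoc,
      Matrix.trace_mul_comm (A * z.2) M, Matrix.mul_assoc M]
  have t2 : (B' * (g * z.2 * gi)).trace = (gi * B' * g * z.2).trace := by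
    rw [← Matrix.mul_assoc, Matrix.trace_mul_comm]
    simp only [Matrix.mul_assoc]
  rw [t1, t2, gB2, hM]
  simp only [Matrix.add_mul, Matrix.sub_mul, Matrix.trace_add, Matrix.trace_sub]
  ring
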